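/- Assume the narrow class group of K is finite. Let T be the set of nonzero fractional ideals J of K such that J = x𝒪 for some totally positive x ∈ K and such that J𝔞 ⊆ 𝒪 for some nonzero integral ideal 𝔞 of minimal norm in its narrow class. Then for every real β > 1 the family (N(J)^{-β})_{J ∈ T} is summable, where N denotes the absolute norm of fractional ideals. -/

import Mathlib

open NumberField FractionalIdeal
open scoped nonZeroDivisors

/-- An element of a number field is *totally positive* if it is positive in every
real embedding. -/
def TotallyPositive (K : Type*) [Field K] (x : K) : Prop :=
  ∀ φ : K →+* ℝ, 0 < φ x

/-- Two fractional ideals of a number field are *narrowly equivalent* if they differ by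
multiplication by a principal fractional ideal with a totally positive generator. -/
def NarrowEquiv (K : Type*) [Field K] [NumberField K]
    (I J : FractionalIdeal (𝓞 K)⁰ K) : Prop :=
  ∃ x : K, x ≠ 0 ∧ TotallyPositive K x ∧ I = spanSingleton (𝓞 K)⁰ x * J

/-- Narrow equivalence of integral ideals. -/
def NarrowEquivI (K : Type*) [Field K] [NumberField K] (I J : Ideal (𝓞 K)) : Prop :=
  NarrowEquiv K (I : FractionalIdeal (𝓞 K)⁰ K) (J : FractionalIdeal (𝓞 K)⁰ K)

/-- A nonzero integral ideal has *minimal norm in its narrow class* if its absolute norm is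
smallest among all nonzero integral ideals narrowly equivalent to it. -/
def MinNorm (K : Type*) [Field K] [NumberField K] (I : Ideal (𝓞 K)) : Prop :=
  ∀ J : Ideal (𝓞 K), J ≠ 0 → NarrowEquivI K J I → Ideal.absNorm I ≤ Ideal.absNorm J

/-- Finiteness of the narrow class group of `K`: there are only finitely many narrow
equivalence classes of nonzero fractional ideals. -/
def NarrowClassFinite (K : Type*) [Field K] [NumberField K] : Prop :=
  ∃ F : Finset (FractionalIdeal (𝓞 K)⁰ K),
    ∀ I : FractionalIdeal (𝓞 K)⁰ K, I ≠ 0 → ∃ J ∈ F, NarrowEquiv K I J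

theorem aux_summable_ideals (K : Type*) [Field K] [NumberField K] (β : ℝ) (hβ : 1 < β) :
    Summable (fun I : Ideal (𝓞 K) => ((Ideal.absNorm I : ℕ) : ℝ) ^ (-β)) := by
  have hL : LSeriesSummable
      (fun n => (((Nat.card {I : Ideal (𝓞 K) // Ideal.absNorm I = n} : ℕ) : ℝ) : ℂ)) (β : ℂ) := by
    refine LSeriesSummable_of_sum_norm_bigO_and_nonneg (r := 1)
      (f := fun n => ((Nat.card {I : Ideal (𝓞 K) // Ideal.absNorm I = n} : ℕ) : ℝ))
      ?_ (fun n => Nat.cast_nonneg _) zero_le_one (by simpa using hβ)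
    have h := (NumberField.Ideal.tendsto_norm_le_div_atTop₀ K).comp
      (tendsto_natCast_atTop_atTop (R := ℝ))
    have h2 := h.isBigO_one ℝ
    have h3 := h2.mul (Asymptotics.isBigO_refl (fun n : ℕ => (n : ℝ)) Filter.atTop)
    refine h3.congr' ?_ ?_
    · filter_upwards [Filter.eventually_ne_atTop 0] with n hn
      have hn' : (n : ℝ) ≠ 0 := Nat.cast_ne_zero.mpr hn
      simp only [Function.comp_apply, Nat.cast_le, ← Nat.cast_sum]
      rw [div_mul_cancel₀ _ hn']
      congr 1
      rw [← add_left_inj 1, ← Ideal.card_norm_le_eq_card_norm_le_add_one,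
        show Finset.Icc 1 n = Finset.Ioc 0 n from Finset.Icc_succ_left_eq_Ioc _ _,
        show 1 = Nat.card {I : Ideal (𝓞 K) // Ideal.absNorm I = 0} by
          simp [Ideal.absNorm_eq_zero_iff],
        Finset.sum_Ioc_add_eq_sum_Icc (n.zero_le),
        ← Finset.card_preimage_eq_sum_card_image_eq
          (fun k _ ↦ Ideal.finite_setOfPred_absNorm_eq k)]
      simp [Set.coe_eq_subtype]
    · filter_upwards with n
      simp
  have hR := hL.norm
  rw [← (Equiv.sigmaFiberEquiv (fun I : Ideal (𝓞 K) => Ideal.absNorm I)).summable_iff,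
    summable_sigma_of_nonneg (fun x => by simp only [Function.comp_apply]; positivity)]
  have hf (n : ℕ) : Finite {I : Ideal (𝓞 K) // Ideal.absNorm I = n} :=
    Ideal.finite_setOfPred_absNorm_eq n
  refine ⟨fun n => ?_, ?_⟩
  · have := hf n
    exact Summable.of_finite
  · refine hR.congr fun n => ?_
    have hc : ∀ y : {I : Ideal (𝓞 K) // Ideal.absNorm I = n},
        ((fun I : Ideal (𝓞 K) => ((Ideal.absNorm I : ℕ) : ℝ) ^ (-β)) ∘
          (Equiv.sigmaFiberEquiv (fun I : Ideal (𝓞 K) => Ideal.absNorm I))) ⟨n, y⟩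
          = (n : ℝ) ^ (-β) := by
      rintro ⟨y, rfl⟩
      rfl
    rw [tsum_congr hc, tsum_const, nsmul_eq_mul, LSeries.norm_term_eq]
    rcases eq_or_ne n 0 with rfl | hn
    · simp [Real.zero_rpow (show -β ≠ 0 by linarith)]
    · rw [if_neg hn, Real.rpow_neg (Nat.cast_nonneg _), div_eq_mul_inv]
      simp

theorem aux_bound (K : Type*) [Field K] [NumberField K] (hfin : NarrowClassFinite K) :
    ∃ B : ℕ, ∀ 𝔞 : Ideal (𝓞 K), 𝔞 ≠ 0 → MinNorm K 𝔞 → Ideal.absNorm 𝔞 ≤ B := by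
  classical
  obtain ⟨F, hF⟩ := hfin
  have key : ∀ J : FractionalIdeal (𝓞 K)⁰ K, ∃ b : ℕ, ∀ 𝔞 : Ideal (𝓞 K), 𝔞 ≠ 0 →
      MinNorm K 𝔞 → NarrowEquiv K (𝔞 : FractionalIdeal (𝓞 K)⁰ K) J → Ideal.absNorm 𝔞 ≤ b := by
    intro J
    by_cases h : ∃ 𝔟 : Ideal (𝓞 K), 𝔟 ≠ 0 ∧ NarrowEquiv K (𝔟 : FractionalIdeal (𝓞 K)⁰ K) J
    · obtain ⟨𝔟, hb0, y, hy0, hy, hby⟩ := h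
      refine ⟨Ideal.absNorm 𝔟, fun 𝔞 ha0 ha ⟨x, hx0, hx, hax⟩ => ha 𝔟 hb0 ?_⟩
      refine ⟨y * x⁻¹, mul_ne_zero hy0 (inv_ne_zero hx0), fun φ => ?_, ?_⟩
      · rw [map_mul, map_inv₀]
        exact mul_pos (hy φ) (inv_pos.mpr (hx φ))
      · rw [hby, hax, ← mul_assoc, spanSingleton_mul_spanSingleton, inv_mul_cancel_right₀ hx0]
    · exact ⟨0, fun 𝔞 ha0 _ he => absurd ⟨𝔞, ha0, he⟩ h⟩
  choose b hb using key
  refine ⟨F.sup b, fun 𝔞 ha0 ha => ?_⟩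
  obtain ⟨J, hJ, he⟩ := hF 𝔞 (coeIdeal_ne_zero.mpr ha0)
  exact (hb J 𝔞 ha0 ha he).trans (Finset.le_sup hJ)

/-- Let `T` be the set of nonzero fractional ideals of `K` generated by a
totally positive element and sent into `𝒪` by multiplication by some nonzero integral ideal
of minimal norm in its narrow class. If the narrow class group of `K` is finite, then for
every real `β > 1` the family `(N(J)^{-β})_{J ∈ T}` is summable. -/
theorem summable_norms_of_S (K : Type*) [Field K] [NumberField K]
    (hfin : NarrowClassFinite K) (β : ℝ) (hβ : 1 < β) :
    Summable (fun J : {J : FractionalIdeal (𝓞 K)⁰ K |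
        (∃ x : K, x ≠ 0 ∧ TotallyPositive K x ∧ J = spanSingleton (𝓞 K)⁰ x) ∧
        ∃ 𝔞 : Ideal (𝓞 K), 𝔞 ≠ 0 ∧ MinNorm K 𝔞 ∧
          J * (𝔞 : FractionalIdeal (𝓞 K)⁰ K) ≤ 1} =>
      ((FractionalIdeal.absNorm J.1 : ℚ) : ℝ) ^ (-β)) := by
  classical
  obtain ⟨B, hB⟩ := aux_bound K hfin
  set c : Ideal (𝓞 K) := Ideal.span {((B.factorial : ℕ) : 𝓞 K)} with hc
  have hc0 : c ≠ 0 := by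
    rw [hc, Ne, Ideal.zero_eq_bot, Ideal.span_singleton_eq_bot]
    exact_mod_cast B.factorial_ne_zero
  have hcf : (c : FractionalIdeal (𝓞 K)⁰ K) ≠ 0 := coeIdeal_ne_zero.mpr hc0
  have hcN : 0 < ((Ideal.absNorm c : ℕ) : ℝ) := by
    have : Ideal.absNorm c ≠ 0 := by
      rw [Ne, Ideal.absNorm_eq_zero_iff]
      exact hc0
    exact_mod_cast Nat.pos_of_ne_zero this
  have key : ∀ J : {J : FractionalIdeal (𝓞 K)⁰ K |
        (∃ x : K, x ≠ 0 ∧ TotallyPositive K x ∧ J = spanSingleton (𝓞 K)⁰ x) ∧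
        ∃ 𝔞 : Ideal (𝓞 K), 𝔞 ≠ 0 ∧ MinNorm K 𝔞 ∧
          J * (𝔞 : FractionalIdeal (𝓞 K)⁰ K) ≤ 1},
      ∃ I : Ideal (𝓞 K), (I : FractionalIdeal (𝓞 K)⁰ K) = J.1 * c := by
    rintro ⟨J, -, 𝔞, ha0, ha, hle⟩
    rw [← le_one_iff_exists_coeIdeal]
    refine le_trans (mul_le_mul_right ?_ J) hle
    rw [coeIdeal_le_coeIdeal, hc, Ideal.span_singleton_le_iff_mem]
    have hpos : 0 < Ideal.absNorm 𝔞 := by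
      refine Nat.pos_of_ne_zero ?_
      rw [Ne, Ideal.absNorm_eq_zero_iff]
      exact ha0
    obtain ⟨k, hk⟩ := Nat.dvd_factorial hpos (hB 𝔞 ha0 ha)
    rw [hk, Nat.cast_mul]
    exact Ideal.mul_mem_right _ _ (Ideal.absNorm_mem 𝔞)
  choose g hg using key
  have hinj : Function.Injective g := by
    intro J J' h
    apply Subtype.ext
    apply mul_right_cancel₀ hcf
    rw [← hg J, ← hg J', h]
  have hs := ((aux_summable_ideals K β hβ).comp_injective hinj).mul_left
    (((Ideal.absNorm c : ℕ) : ℝ) ^ β)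
  refine hs.congr fun J => ?_
  have hN : ((Ideal.absNorm (g J) : ℕ) : ℝ) =
      ((FractionalIdeal.absNorm J.1 : ℚ) : ℝ) * ((Ideal.absNorm c : ℕ) : ℝ) := by
    have := congrArg (FractionalIdeal.absNorm (K := K)) (hg J)
    rw [map_mul, coeIdeal_absNorm, coeIdeal_absNorm] at this
    exact_mod_cast this
  have hJ : 0 ≤ ((FractionalIdeal.absNorm J.1 : ℚ) : ℝ) := by
    exact_mod_cast absNorm_nonneg J.1
  simp only [Function.comp_apply]
  rw [hN, Real.mul_rpow hJ hcN.le, mul_left_comm, ← Real.rpow_add hcN]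
  simp
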